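/- For every n ≥ 2, the first discriminant-resultant vanishes identically: DR_{n,1} = 0. -/

import Mathlib

open Polynomial Finset

/-- The resultant of two binary forms of (formal) degrees `d` and `e`, given by their
dehomogenizations. -/
noncomputable def res {k : Type*} [CommRing k] (d e : ℕ) (p q : Polynomial k) : k :=
  (-1 : k) ^ (d * e) *
    Matrix.det (Matrix.of fun i j : Fin (d + e) =>
      if (i : ℕ) < e then
        (if (i : ℕ) ≤ (j : ℕ) ∧ (j : ℕ) ≤ d + (i : ℕ) then
          p.coeff (d + (i : ℕ) - (j : ℕ)) else 0)
      else
        (if (i : ℕ) - e ≤ (j : ℕ) ∧ (j : ℕ) ≤ (i : ℕ) then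
          q.coeff ((i : ℕ) - (j : ℕ)) else 0))

/-- The bracket `[u,v] = u₀v₁ - v₀u₁`. -/
def bracket {k : Type*} [CommRing k] (u v : Fin 2 → k) : k := u 0 * v 1 - v 0 * u 1

/-- The numerator of the discriminant-resultant generating polynomial:
`res(f_n, x ∂ₓ f_n + t·x·y·f_{n-2})`, computed over `k[t]`. -/
noncomputable def DRnum {k : Type*} [CommRing k] (n : ℕ) (p q : Polynomial k) :
    Polynomial k :=
  res n n (p.map (Polynomial.C : k →+* Polynomial k))
    (Polynomial.X * (Polynomial.derivative p).map (Polynomial.C : k →+* Polynomial k) +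
      Polynomial.C (Polynomial.X : Polynomial k) * Polynomial.X *
        (q.map (Polynomial.C : k →+* Polynomial k)))

/-- The `r`-th discriminant-resultant `DR_{n,r}`: the coefficient of `t^r` in
`res(f_n, x ∂ₓ f_n + t·x·y·f_{n-2}) / (a₀ aₙ)`. -/
noncomputable def DR {k : Type*} [Field k] (n r : ℕ) (p q : Polynomial k) : k :=
  (DRnum n p q).coeff r / (p.coeff 0 * p.coeff n)

/-- `res` agrees with Mathlib's resultant up to the sign `(-1) ^ (d * e)`. -/
lemma res_eq_resultant {R : Type*} [CommRing R] (d e : ℕ) (p q : R[X]) :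
    res d e p q = (-1) ^ (d * e) * resultant p q d e := by
  rw [res, resultant, ← Matrix.det_transpose (sylvester p q d e),
    ← Matrix.det_submatrix_equiv_self Fin.revPerm]
  congr 2
  ext i j
  induction i using Fin.addCases with
  | left i =>
    have h₁ : ¬ d + e - ((i : ℕ) + 1) < e := by lia
    simp only [sylvester, Matrix.of_apply, Matrix.submatrix_apply, Matrix.transpose_apply,
      Fin.revPerm_apply, Fin.addCases_left, Fin.val_rev, Fin.val_castAdd, h₁,
      if_false, Set.mem_Icc]
    have h₂ : d + e - ((i : ℕ) + 1) - (d + e - ((j : ℕ) + 1)) = j - i := by lia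
    rw [h₂]
    exact if_congr (by lia) rfl rfl
  | right i =>
    have h₁ : d + e - (d + (i : ℕ) + 1) < e := by lia
    simp only [sylvester, Matrix.of_apply, Matrix.submatrix_apply, Matrix.transpose_apply,
      Fin.revPerm_apply, Fin.addCases_right, Fin.val_rev, Fin.val_natAdd, h₁,
      if_true, Set.mem_Icc]
    have h₂ : d + (d + e - (d + (i : ℕ) + 1)) - (d + e - ((j : ℕ) + 1)) = j - i := by lia
    rw [h₂]
    exact if_congr (by lia) rfl rfl

lemma DRnum_map {R S : Type*} [CommRing R] [CommRing S] (φ : R →+* S) (n : ℕ) (p q : R[X]) :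
    DRnum n (p.map φ) (q.map φ) = (DRnum n p q).map φ := by
  have hC : (C : S →+* S[X]).comp φ = (mapRingHom φ).comp C := by ext; simp
  have hmap (f : R[X]) : (f.map φ).map C = (f.map C).map (mapRingHom φ) := by
    rw [Polynomial.map_map, Polynomial.map_map, hC]
  simp only [DRnum, res_eq_resultant, derivative_map, hmap]
  rw [← coe_mapRingHom φ, map_mul (mapRingHom φ), ← resultant_map_map,
    Polynomial.map_add, Polynomial.map_mul, Polynomial.map_mul, Polynomial.map_mul, map_X, map_C,
    coe_mapRingHom, map_X]
  simp only [Polynomial.map_pow, Polynomial.map_neg, Polynomial.map_one]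

/-- Lagrange interpolation: if `p` has simple roots, then the sum of `q(a) / (derivative p)(a)`,
where `a` runs through the roots of `p`, vanishes as soon as `deg q + 2 ≤ deg p`. -/
lemma sum_roots_eval_div_eval_derivative_eq_zero {K : Type*} [Field K] [DecidableEq K]
    {p q : K[X]} (hs : p.Splits) (hnd : p.roots.Nodup) (hq : q.natDegree + 2 ≤ p.natDegree) :
    ∑ a ∈ p.roots.toFinset, q.eval a / (derivative p).eval a = 0 := by
  have hcard : #p.roots.toFinset = p.natDegree := by
    rw [Multiset.toFinset_card_of_nodup hnd, hs.natDegree_eq_card_roots]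
  have hsum := Lagrange.coeff_eq_sum (s := p.roots.toFinset) (v := id)
    Function.injective_id.injOn (P := q)
    (degree_le_natDegree.trans_lt (by rw [hcard]; exact_mod_cast (by lia)))
  rw [hcard, coeff_eq_zero_of_natDegree_lt (by lia)] at hsum
  have hp : p = C p.leadingCoeff * Lagrange.nodal p.roots.toFinset id := by
    conv_lhs => rw [hs.eq_prod_roots]
    rw [Lagrange.nodal_eq, Finset.prod_eq_multiset_prod, Multiset.toFinset_val, hnd.dedup]
    rfl
  have hd (a : K) (ha : a ∈ p.roots.toFinset) : (derivative p).eval a =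
      p.leadingCoeff * ∏ b ∈ p.roots.toFinset.erase a, (id a - id b) := by
    conv_lhs => rw [hp]
    rw [derivative_C_mul, eval_C_mul, ← Lagrange.eval_nodal,
      ← Lagrange.eval_nodal_derivative_eval_node_eq ha, id]
  calc ∑ a ∈ p.roots.toFinset, q.eval a / (derivative p).eval a
      = p.leadingCoeff⁻¹ * ∑ a ∈ p.roots.toFinset,
          q.eval (id a) / ∏ b ∈ p.roots.toFinset.erase a, (id a - id b) := by
        rw [Finset.mul_sum]
        refine Finset.sum_congr rfl fun a ha => ?_
        rw [hd a ha, id, div_mul_eq_div_div_swap, div_eq_inv_mul]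
    _ = 0 := by rw [← hsum, mul_zero]

lemma coeff_one_prod_C_add_X_mul_C {R ι : Type*} [CommRing R] [DecidableEq ι] (s : Finset ι)
    (u v : ι → R) :
    (∏ i ∈ s, (C (u i) + X * C (v i))).coeff 1 = ∑ i ∈ s, (∏ j ∈ s.erase i, u j) * v i := by
  have h := coeff_derivative (∏ i ∈ s, (C (u i) + X * C (v i))) 0
  rw [Nat.cast_zero, zero_add, zero_add, mul_one] at h
  rw [← h, derivative_prod_finset, coeff_zero_eq_eval_zero, eval_finsetSum]
  simp [eval_prod]

lemma coeff_one_prod_roots_eq_zero {K : Type*} [Field K] {p q : K[X]} (hs : p.Splits)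
    (hq : q.natDegree + 2 ≤ p.natDegree) :
    (p.roots.map fun a =>
      C (a * (derivative p).eval a) + X * C (a * q.eval a)).prod.coeff 1 = 0 := by
  classical
  have hp0 : p ≠ 0 := by
    rintro rfl
    simp at hq
  by_cases hnd : p.roots.Nodup
  · have hd (a : K) (ha : a ∈ p.roots.toFinset) : (derivative p).eval a ≠ 0 := by
      have hroot := Multiset.mem_toFinset.mp ha
      intro h0
      have h1 : 1 < p.rootMultiplicity a :=
        (one_lt_rootMultiplicity_iff_isRoot hp0).mpr ⟨isRoot_of_mem_roots hroot, h0⟩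
      rw [← count_roots] at h1
      exact absurd (Multiset.nodup_iff_count_le_one.mp hnd a) (by lia)
    have hprod := coeff_one_prod_C_add_X_mul_C p.roots.toFinset
      (fun a => a * (derivative p).eval a) (fun a => a * q.eval a)
    rw [Finset.prod_eq_multiset_prod, Multiset.toFinset_val, hnd.dedup] at hprod
    rw [hprod]
    calc _ = (∏ a ∈ p.roots.toFinset, a * (derivative p).eval a) *
          ∑ a ∈ p.roots.toFinset, q.eval a / (derivative p).eval a := by
          rw [Finset.mul_sum]
          refine Finset.sum_congr rfl fun a ha => ?_
          rw [← Finset.prod_erase_mul _ _ ha]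
          have := hd a ha
          field_simp
      _ = 0 := by rw [sum_roots_eval_div_eval_derivative_eq_zero hs hnd hq, mul_zero]
  · rw [Multiset.nodup_iff_count_le_one] at hnd
    push Not at hnd
    obtain ⟨a, ha⟩ := hnd
    have hd : (derivative p).eval a = 0 := by
      rw [count_roots] at ha
      exact ((one_lt_rootMultiplicity_iff_isRoot hp0).mp ha).2
    obtain ⟨s, hroots⟩ := Multiset.le_iff_exists_add.mp (Multiset.le_count_iff_replicate_le.mp ha)
    have hX : X ^ 2 ∣ (p.roots.map fun a =>
        C (a * (derivative p).eval a) + X * C (a * q.eval a)).prod := by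
      rw [hroots, Multiset.map_add, Multiset.prod_add, Multiset.map_replicate,
        Multiset.prod_replicate, hd, mul_zero, C_0, zero_add, mul_pow]
      exact (Dvd.intro _ rfl).mul_right _
    exact X_pow_dvd_iff.mp hX 1 one_lt_two

lemma coeff_one_DRnum_of_splits {K : Type*} [Field K] {p q : K[X]} (hs : p.Splits)
    (hq : q.natDegree + 2 ≤ p.natDegree) :
    (DRnum p.natDegree p q).coeff 1 = 0 := by
  set g : K[X][X] := X * (derivative p).map C + C X * X * q.map C
  have hg : g.natDegree ≤ p.natDegree := by
    refine natDegree_add_le_of_degree_le ?_ ?_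
    · refine natDegree_mul_le.trans ?_
      have h₁ := (natDegree_map_le (f := (C : K →+* K[X])) (p := derivative p)).trans
        (natDegree_derivative_le p)
      have h₂ := natDegree_X_le (R := K[X])
      lia
    · refine natDegree_mul_le.trans ?_
      have h₁ := natDegree_map_le (f := (C : K →+* K[X])) (p := q)
      have h₂ := (natDegree_C_mul_le (X : K[X]) X).trans natDegree_X_le
      lia
  have heval (a : K) : g.eval (C a) =
      C (a * (derivative p).eval a) + X * C (a * q.eval a) := by
    simp only [g, eval_add, eval_mul, eval_X, eval_C, eval_map_apply, C_mul]
    ring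
  have hres := resultant_eq_prod_eval (p.map C) g p.natDegree hg (hs.map C)
  rw [natDegree_map_eq_of_injective C_injective, leadingCoeff_map_of_injective C_injective,
    hs.roots_map_of_injective C_injective, Multiset.map_map] at hres
  simp only [Function.comp_def, heval] at hres
  rw [DRnum, res_eq_resultant, hres, ← C_1, ← C_neg, ← C_pow, ← C_pow, coeff_C_mul, coeff_C_mul,
    coeff_one_prod_roots_eq_zero hs hq, mul_zero, mul_zero]

/-- The first discriminant-resultant vanishes identically: `DR_{n,1} = 0`. -/
theorem DR_one_eq_zero {k : Type*} [Field k] [CharZero k] (n : ℕ) (hn : 2 ≤ n)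
    (p q : Polynomial k) (hp : p.natDegree ≤ n) (hq : q.natDegree ≤ n - 2)
    (ha : p.coeff 0 * p.coeff n ≠ 0) :
    DR n 1 p q = 0 := by
  obtain rfl : p.natDegree = n :=
    le_antisymm hp (le_natDegree_of_ne_zero (right_ne_zero_of_mul ha))
  let φ := algebraMap k (AlgebraicClosure k)
  have h := coeff_one_DRnum_of_splits (p := p.map φ) (q := q.map φ) (IsAlgClosed.splits _)
    (by rw [natDegree_map, natDegree_map]; lia)
  rw [natDegree_map, DRnum_map, coeff_map, map_eq_zero] at h
  rw [DR, h, zero_div]
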